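/- arXiv:1404.5608 — 3 statements merged into one kernel-verified Lean document; each statement's English description precedes it below -/
import Mathlib

section
/- Let d > 0 and let w ∈ L²_{2π,0} have Fourier expansion w(t) = Σ_{n≥1} a_n cos nt + Σ_{n≥1} b_n sin nt. Let W(x,y) = Σ_{n≥1} (sinh(n(y+d))/sinh(nd))(a_n cos nx + b_n sin nx) and Z(x,y) = Σ_{n≥1} (cosh(n(y+d))/sinh(nd))(a_n sin nx − b_n cos nx). Then both series converge for every (x,y) ∈ R_d, the function z = x + iy ↦ Z(x,y) + iW(x,y) is holomorphic on the strip {z ∈ ℂ : −d < Im z < 0}, is 2π-periodic (i.e., invariant under z ↦ z + 2π), and its imaginary part vanishes on approach to the line Im z = −d. -/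
open Real MeasureTheory Filter

/-- mean of a `2π`-periodic function over one period -/
noncomputable def mean2 (f : ℝ → ℝ) : ℝ := (1 / (2 * π)) * ∫ t in (-π)..π, f t

/-- cosine Fourier coefficient -/
noncomputable def fcos (f : ℝ → ℝ) (n : ℕ) : ℝ :=
  (1 / π) * ∫ t in (-π)..π, f t * Real.cos (n * t)

/-- sine Fourier coefficient -/
noncomputable def fsin (f : ℝ → ℝ) (n : ℕ) : ℝ :=
  (1 / π) * ∫ t in (-π)..π, f t * Real.sin (n * t)

/-- complex form of the general term -/
noncomputable def gterm (d : ℝ) (a b : ℕ → ℝ) (n : ℕ) (z : ℂ) : ℂ :=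
  ((a n : ℂ) * Complex.sin (((n : ℂ) + 1) * (z + d * Complex.I))
    - (b n : ℂ) * Complex.cos (((n : ℂ) + 1) * (z + d * Complex.I)))
    / ((Real.sinh (((n : ℝ) + 1) * d) : ℝ) : ℂ)

lemma gterm_eq (d : ℝ) (a b : ℕ → ℝ) (n : ℕ) (z : ℂ) :
    gterm d a b n z =
      ((Real.cosh ((n + 1) * (z.im + d)) / Real.sinh ((n + 1) * d) *
        (a n * Real.sin ((n + 1) * z.re) - b n * Real.cos ((n + 1) * z.re)) : ℝ) : ℂ)
      + ((Real.sinh ((n + 1) * (z.im + d)) / Real.sinh ((n + 1) * d) *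
        (a n * Real.cos ((n + 1) * z.re) + b n * Real.sin ((n + 1) * z.re)) : ℝ) : ℂ)
        * Complex.I := by
  have h : ((n : ℂ) + 1) * (z + d * Complex.I)
      = ((((n : ℝ) + 1) * z.re : ℝ) : ℂ)
        + ((((n : ℝ) + 1) * (z.im + d) : ℝ) : ℂ) * Complex.I := by
    conv_lhs => rw [← Complex.re_add_im z]
    push_cast
    ring
  unfold gterm
  rw [h, Complex.sin_add_mul_I, Complex.cos_add_mul_I]
  push_cast
  simp only [div_eq_mul_inv]
  ring_nf

lemma abs_comb_le {C a b s c : ℝ} (ha : |a| ≤ C) (hb : |b| ≤ C) (hs : |s| ≤ 1) (hc : |c| ≤ 1) :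
    |a * s| + |b * c| ≤ 2 * C := by
  rw [abs_mul, abs_mul]
  nlinarith [abs_nonneg a, abs_nonneg b, abs_nonneg s, abs_nonneg c]

lemma ratio_le {d s t : ℝ} (hd : 0 < d) (n : ℕ) (hs : |t| ≤ s) :
    Real.cosh ((n + 1) * t) / Real.sinh ((n + 1) * d)
      ≤ 2 / (1 - Real.exp (-(2 * d))) * Real.exp (-(d - s)) ^ (n + 1) := by
  have hn : (0 : ℝ) < (n : ℝ) + 1 := by positivity
  have h1 : Real.cosh ((n + 1) * t) ≤ Real.exp ((n + 1) * s) := by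
    have : Real.cosh ((n + 1) * t) ≤ Real.cosh ((n + 1) * s) := by
      rw [Real.cosh_le_cosh, abs_mul, abs_mul, abs_of_pos hn]
      exact mul_le_mul_of_nonneg_left (hs.trans (le_abs_self s)) hn.le
    refine this.trans ?_
    rw [Real.cosh_eq]
    have : Real.exp (-((n + 1) * s)) ≤ Real.exp ((n + 1) * s) := by
      apply Real.exp_le_exp.mpr
      have := mul_nonneg hn.le ((abs_nonneg t).trans hs)
      linarith
    linarith
  have hpos : 0 < 1 - Real.exp (-(2 * d)) := by
    have : Real.exp (-(2 * d)) < 1 := Real.exp_lt_one_iff.mpr (by linarith)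
    linarith
  have h2 : Real.exp ((n + 1) * d) * (1 - Real.exp (-(2 * d))) / 2 ≤ Real.sinh ((n + 1) * d) := by
    rw [Real.sinh_eq]
    have : Real.exp (-((n + 1) * d)) ≤ Real.exp ((n + 1) * d) * Real.exp (-(2 * d)) := by
      rw [← Real.exp_add]
      apply Real.exp_le_exp.mpr
      have : (0 : ℝ) ≤ n * d := by positivity
      linarith
    linarith
  have h3 : 0 < Real.exp ((n + 1) * d) * (1 - Real.exp (-(2 * d))) / 2 := by
    have := Real.exp_pos ((n + 1) * d)
    positivity
  refine (div_le_div₀ (Real.exp_pos _).le h1 h3 h2).trans (le_of_eq ?_)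
  rw [← Real.exp_nat_mul]
  have : Real.exp ((n + 1) * s) = Real.exp ((n + 1) * d) * Real.exp (((n + 1 : ℕ) : ℝ) * -(d - s)) := by
    rw [← Real.exp_add]
    congr 1
    push_cast
    ring
  rw [this]
  have h4 := (Real.exp_pos ((n + 1) * d)).ne'
  have h5 := hpos.ne'
  field_simp

lemma gterm_bound {d s C : ℝ} {a b : ℕ → ℝ} (hd : 0 < d) (ha : ∀ n, |a n| ≤ C)
    (hb : ∀ n, |b n| ≤ C) (n : ℕ) (z : ℂ) (hz : |z.im + d| ≤ s) :
    ‖gterm d a b n z‖ ≤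
      4 * C * (2 / (1 - Real.exp (-(2 * d))) * Real.exp (-(d - s)) ^ (n + 1)) := by
  have hr := ratio_le hd n hz
  have hsd : 0 < Real.sinh (((n : ℝ) + 1) * d) := Real.sinh_pos_iff.mpr (by positivity)
  have hC : 0 ≤ C := (abs_nonneg _).trans (ha 0)
  have hsc : |Real.sinh ((n + 1) * (z.im + d))| ≤ Real.cosh ((n + 1) * (z.im + d)) := by
    rw [abs_le]
    constructor
    · have := Real.cosh_add_sinh (((n : ℝ) + 1) * (z.im + d))
      have := Real.exp_pos (((n : ℝ) + 1) * (z.im + d))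
      linarith
    · exact (Real.sinh_lt_cosh _).le
  rw [gterm_eq]
  refine (norm_add_le _ _).trans ?_
  rw [norm_mul, Complex.norm_I, mul_one, Complex.norm_real, Complex.norm_real, norm_mul, norm_mul,
    norm_div, norm_div]
  simp only [Real.norm_eq_abs]
  rw [abs_of_pos hsd, abs_of_pos (Real.cosh_pos _)]
  have e1 : |a n * Real.sin ((n + 1) * z.re) - b n * Real.cos ((n + 1) * z.re)| ≤ 2 * C :=
    (abs_sub _ _).trans
      (abs_comb_le (ha n) (hb n) (Real.abs_sin_le_one _) (Real.abs_cos_le_one _))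
  have e2 : |a n * Real.cos ((n + 1) * z.re) + b n * Real.sin ((n + 1) * z.re)| ≤ 2 * C :=
    (abs_add_le _ _).trans
      (abs_comb_le (ha n) (hb n) (Real.abs_cos_le_one _) (Real.abs_sin_le_one _))
  have hr2 : |Real.sinh ((n + 1) * (z.im + d))| / Real.sinh ((n + 1) * d)
      ≤ 2 / (1 - Real.exp (-(2 * d))) * Real.exp (-(d - s)) ^ (n + 1) :=
    (div_le_div_of_nonneg_right hsc hsd.le).trans hr
  have hB : 0 ≤ 2 / (1 - Real.exp (-(2 * d))) * Real.exp (-(d - s)) ^ (n + 1) :=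
    le_trans (by have := Real.cosh_pos ((n + 1) * (z.im + d)); positivity) hr
  have f1 := mul_le_mul hr e1 (abs_nonneg _) hB
  have f2 := mul_le_mul hr2 e2 (abs_nonneg _) hB
  linarith

lemma bound_summable {d s C : ℝ} (hs : s < d) :
    Summable (fun n : ℕ =>
      4 * C * (2 / (1 - Real.exp (-(2 * d))) * Real.exp (-(d - s)) ^ (n + 1))) := by
  apply Summable.mul_left
  apply Summable.mul_left
  rw [summable_nat_add_iff (f := fun n : ℕ => Real.exp (-(d - s)) ^ n) 1]
  exact summable_geometric_of_lt_one (Real.exp_pos _).le (Real.exp_lt_one_iff.mpr (by linarith))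

lemma gterm_diff (d : ℝ) (a b : ℕ → ℝ) (n : ℕ) : Differentiable ℂ (gterm d a b n) := by
  unfold gterm
  fun_prop

lemma gsum_diffAt {d C : ℝ} {a b : ℕ → ℝ} (hd : 0 < d) (ha : ∀ n, |a n| ≤ C)
    (hb : ∀ n, |b n| ≤ C) (z : ℂ) (hz : |z.im + d| < d) :
    DifferentiableAt ℂ (fun z => ∑' n, gterm d a b n z) z := by
  obtain ⟨s, hs1, hs2⟩ := exists_between hz
  have ho : IsOpen {z : ℂ | |z.im + d| < s} :=
    isOpen_lt (by fun_prop) continuous_const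
  exact (Complex.differentiableOn_tsum_of_summable_norm (bound_summable (C := C) hs2)
    (fun n => (gterm_diff d a b n).differentiableOn) ho
    (fun n z hz => gterm_bound hd ha hb n z (le_of_lt hz))).differentiableAt (ho.mem_nhds hs1)

lemma gterm_summable {d C : ℝ} {a b : ℕ → ℝ} (hd : 0 < d) (ha : ∀ n, |a n| ≤ C)
    (hb : ∀ n, |b n| ≤ C) (z : ℂ) (hz : |z.im + d| < d) :
    Summable (fun n => gterm d a b n z) :=
  Summable.of_norm_bounded (bound_summable (C := C) hz)
    (fun n => gterm_bound hd ha hb n z le_rfl)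

lemma coef_bound {w g : ℝ → ℝ} (hw : IntegrableOn w (Set.Ioc (-π) π)) (hg : ∀ t, |g t| ≤ 1) :
    |(1 / π) * ∫ t in (-π)..π, w t * g t| ≤ (1 / π) * ∫ t in (-π)..π, |w t| := by
  rw [abs_mul, abs_of_pos (by positivity : (0:ℝ) < 1 / π)]
  refine mul_le_mul_of_nonneg_left ?_ (by positivity)
  have hpi : -π ≤ π := by linarith [Real.pi_pos]
  rw [← Real.norm_eq_abs]
  refine intervalIntegral.norm_integral_le_of_norm_le hpi ?_ ?_
  · refine Eventually.of_forall fun t _ => ?_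
    rw [Real.norm_eq_abs, abs_mul]
    nlinarith [abs_nonneg (w t), hg t]
  · rw [intervalIntegrable_iff_integrableOn_Ioc_of_le hpi]
    exact hw.abs

/-- for `w ∈ L²_{2π,0}`, the series
`W(x,y) = Σ_{n≥1} (sinh(n(y+d))/sinh(nd))(aₙ cos nx + bₙ sin nx)` and
`Z(x,y) = Σ_{n≥1} (cosh(n(y+d))/sinh(nd))(aₙ sin nx − bₙ cos nx)` converge on `R_d`,
the function `z ↦ Z + iW` is holomorphic on the strip `{−d < Im z < 0}`, `2π`-periodic,
and its imaginary part vanishes on approach to the line `Im z = −d`. -/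
theorem stmt3 (d : ℝ) (hd : 0 < d) (w : ℝ → ℝ)
    (hmeas : AEStronglyMeasurable w volume)
    (hper : Function.Periodic w (2 * π))
    (hL2 : IntegrableOn (fun t => (w t) ^ 2) (Set.Ioc (-π) π))
    (hmean : mean2 w = 0)
    (Wf Zf : ℝ → ℝ → ℝ) (F : ℂ → ℂ)
    (hWf : Wf = fun x y =>
      ∑' n : ℕ, Real.sinh ((n + 1) * (y + d)) / Real.sinh ((n + 1) * d) *
        (fcos w (n + 1) * Real.cos ((n + 1) * x) + fsin w (n + 1) * Real.sin ((n + 1) * x)))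
    (hZf : Zf = fun x y =>
      ∑' n : ℕ, Real.cosh ((n + 1) * (y + d)) / Real.sinh ((n + 1) * d) *
        (fcos w (n + 1) * Real.sin ((n + 1) * x) - fsin w (n + 1) * Real.cos ((n + 1) * x)))
    (hF : F = fun z : ℂ => (Zf z.re z.im : ℂ) + (Wf z.re z.im : ℂ) * Complex.I) :
    (∀ x y : ℝ, -d < y → y < 0 →
        Summable (fun n : ℕ => Real.sinh ((n + 1) * (y + d)) / Real.sinh ((n + 1) * d) *
          (fcos w (n + 1) * Real.cos ((n + 1) * x) + fsin w (n + 1) * Real.sin ((n + 1) * x)))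
        ∧ Summable (fun n : ℕ => Real.cosh ((n + 1) * (y + d)) / Real.sinh ((n + 1) * d) *
          (fcos w (n + 1) * Real.sin ((n + 1) * x) - fsin w (n + 1) * Real.cos ((n + 1) * x))))
    ∧ DifferentiableOn ℂ F {z : ℂ | -d < z.im ∧ z.im < 0}
    ∧ (∀ z : ℂ, -d < z.im → z.im < 0 → F (z + (2 * π : ℝ)) = F z)
    ∧ (∀ z₀ : ℂ, z₀.im = -d →
        Tendsto (fun z => (F z).im)
          (nhdsWithin z₀ {z : ℂ | -d < z.im ∧ z.im < 0}) (nhds 0)) := by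
  have hw : IntegrableOn w (Set.Ioc (-π) π) := by
    have h2 : MemLp w 2 (volume.restrict (Set.Ioc (-π) π)) :=
      (memLp_two_iff_integrable_sq hmeas.restrict).mpr hL2
    exact h2.integrable (by norm_num)
  obtain ⟨C, hC⟩ : ∃ C, C = (1 / π) * ∫ t in (-π)..π, |w t| := ⟨_, rfl⟩
  have ha : ∀ n : ℕ, |(fun n : ℕ => fcos w (n + 1)) n| ≤ C := fun n => by
    rw [hC]; exact coef_bound hw (fun t => Real.abs_cos_le_one _)
  have hb : ∀ n : ℕ, |(fun n : ℕ => fsin w (n + 1)) n| ≤ C := fun n => by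
    rw [hC]; exact coef_bound hw (fun t => Real.abs_sin_le_one _)
  set a : ℕ → ℝ := fun n => fcos w (n + 1) with hadef
  set b : ℕ → ℝ := fun n => fsin w (n + 1) with hbdef
  have hsum : ∀ z : ℂ, |z.im + d| < d → HasSum (fun n => gterm d a b n z) (∑' n, gterm d a b n z) :=
    fun z hz => (gterm_summable hd ha hb z hz).hasSum
  have hre : ∀ z : ℂ, |z.im + d| < d →
      HasSum (fun n : ℕ => Real.cosh ((n + 1) * (z.im + d)) / Real.sinh ((n + 1) * d) *
        (fcos w (n + 1) * Real.sin ((n + 1) * z.re) - fsin w (n + 1) * Real.cos ((n + 1) * z.re)))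
        (∑' n, gterm d a b n z).re := fun z hz => by
    convert Complex.hasSum_re (hsum z hz) using 2 with n
    rw [gterm_eq]; simp only [Complex.add_re, Complex.ofReal_re, Complex.re_ofReal_mul, Complex.I_re, mul_zero, add_zero, hadef, hbdef]
  have him : ∀ z : ℂ, |z.im + d| < d →
      HasSum (fun n : ℕ => Real.sinh ((n + 1) * (z.im + d)) / Real.sinh ((n + 1) * d) *
        (fcos w (n + 1) * Real.cos ((n + 1) * z.re) + fsin w (n + 1) * Real.sin ((n + 1) * z.re)))
        (∑' n, gterm d a b n z).im := fun z hz => by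
    convert Complex.hasSum_im (hsum z hz) using 2 with n
    rw [gterm_eq]; simp only [Complex.add_im, Complex.ofReal_im, Complex.im_ofReal_mul, Complex.I_im, mul_one, zero_add, hadef, hbdef]
  have hFG : ∀ z : ℂ, |z.im + d| < d → F z = ∑' n, gterm d a b n z := fun z hz => by
    rw [hF, hZf, hWf]
    simp only
    rw [(hre z hz).tsum_eq, (him z hz).tsum_eq, Complex.re_add_im]
  have hstrip : ∀ y : ℝ, -d < y → y < 0 → |y + d| < d := fun y h1 h2 => by
    rw [abs_lt]; constructor <;> linarith
  refine ⟨fun x y h1 h2 => ⟨?_, ?_⟩, ?_, ?_, ?_⟩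
  · exact (him ⟨x, y⟩ (hstrip y h1 h2)).summable
  · exact (hre ⟨x, y⟩ (hstrip y h1 h2)).summable
  · have hd1 : DifferentiableOn ℂ (fun z => ∑' n, gterm d a b n z)
        {z : ℂ | -d < z.im ∧ z.im < 0} := fun z hz =>
      (gsum_diffAt hd ha hb z (hstrip _ hz.1 hz.2)).differentiableWithinAt
    exact hd1.congr fun z hz => hFG z (hstrip _ hz.1 hz.2)
  · intro z h1 h2
    have hcos : ∀ (n : ℕ) (x : ℝ), Real.cos ((n + 1) * (x + 2 * π)) = Real.cos ((n + 1) * x) := by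
      intro n x
      have := Real.cos_add_nat_mul_two_pi ((n + 1) * x) (n + 1)
      rw [← this]
      congr 1
      push_cast
      ring
    have hsin : ∀ (n : ℕ) (x : ℝ), Real.sin ((n + 1) * (x + 2 * π)) = Real.sin ((n + 1) * x) := by
      intro n x
      have := Real.sin_add_nat_mul_two_pi ((n + 1) * x) (n + 1)
      rw [← this]
      congr 1
      push_cast
      ring
    rw [hF, hZf, hWf]
    simp only [Complex.add_re, Complex.add_im, Complex.ofReal_re, Complex.ofReal_im, add_zero,
      hcos, hsin]
  · intro z₀ hz₀
    have hz : |z₀.im + d| < d := by rw [hz₀]; simpa using hd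
    have h0 : (∑' n, gterm d a b n z₀).im = 0 := by
      rw [← (him z₀ hz).tsum_eq]
      simp [hz₀]
    have hc : Tendsto (fun z => (∑' n, gterm d a b n z).im)
        (nhdsWithin z₀ {z : ℂ | -d < z.im ∧ z.im < 0}) (nhds 0) := by
      rw [← h0]
      exact ((Complex.continuous_im.continuousAt.comp
        (gsum_diffAt hd ha hb z₀ hz).continuousAt).tendsto).mono_left nhdsWithin_le_nhds
    refine hc.congr' ?_
    filter_upwards [self_mem_nhdsWithin] with z hz
    rw [hFG z (hstrip _ hz.1 hz.2)]
end

section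
/- Let d > 0 and let B be a complex-valued function, continuous and nowhere vanishing on the closed strip {z ∈ ℂ : −d ≤ Im z ≤ 0}, holomorphic on the open strip, 2π-periodic (B(z + 2π) = B(z)), real-valued on the line Im z = −d, and satisfying (1/2π)∫_{−π}^{π} Re B(x) dx = 1 (the integral over the line Im z = 0). Then B(x − id) > 0 for all x ∈ ℝ, and (1/2π)∫_{−π}^{π} Re (1/B)(x) dx > 0, where the last integral is taken over the line Im z = 0. -/
open Real

lemma strip_shift (d : ℝ) (hd : 0 < d) (F : ℂ → ℂ)
    (hcont : ContinuousOn F {z : ℂ | -d ≤ z.im ∧ z.im ≤ 0})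
    (hhol : DifferentiableOn ℂ F {z : ℂ | -d < z.im ∧ z.im < 0})
    (hper : ∀ z : ℂ, -d ≤ z.im → z.im ≤ 0 → F (z + (2 * π : ℝ)) = F z) :
    ∫ x in (-π)..π, F (x : ℝ) = ∫ x in (-π)..π, F ((x : ℝ) - d * Complex.I) := by
  have key := Complex.integral_boundary_rect_eq_zero_of_continuousOn_of_differentiableOn F
    ⟨-π, -d⟩ ⟨π, 0⟩ (hcont.mono ?_) (hhol.mono ?_)
  · simp only at key
    have hs : (∫ y in (-d)..0, F ((π : ℝ) + (y : ℝ) * Complex.I))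
        = ∫ y in (-d)..0, F (((-π : ℝ) : ℂ) + (y : ℝ) * Complex.I) := by
      apply intervalIntegral.integral_congr
      intro y hy
      rw [Set.uIcc_of_le (by linarith)] at hy
      have := hper (((-π : ℝ) : ℂ) + (y : ℝ) * Complex.I) (by simpa using hy.1)
        (by simpa using hy.2)
      simp only
      rw [← this]
      congr 1
      push_cast
      ring
    rw [hs, add_sub_cancel_right, sub_eq_zero] at key
    simp only [Complex.ofReal_zero, zero_mul, add_zero] at key
    rw [← key]
    apply intervalIntegral.integral_congr
    intro x _
    simp only
    congr 1
    push_cast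
    ring
  · intro z hz
    have h2 := hz.2
    simp only [Set.mem_preimage] at h2
    rw [Set.uIcc_of_le (by linarith)] at h2
    exact h2
  · intro z hz
    have h2 := hz.2
    simp only [Set.mem_preimage] at h2
    rw [min_eq_left (by linarith), max_eq_right (by linarith)] at h2
    exact h2

lemma strip_shift_re (d : ℝ) (hd : 0 < d) (F : ℂ → ℂ)
    (hcont : ContinuousOn F {z : ℂ | -d ≤ z.im ∧ z.im ≤ 0})
    (hhol : DifferentiableOn ℂ F {z : ℂ | -d < z.im ∧ z.im < 0})
    (hper : ∀ z : ℂ, -d ≤ z.im → z.im ≤ 0 → F (z + (2 * π : ℝ)) = F z) :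
    Continuous (fun x : ℝ => F (x - d * Complex.I)) ∧
    ∫ x in (-π)..π, (F (x : ℝ)).re = ∫ x in (-π)..π, (F ((x : ℝ) - d * Complex.I)).re := by
  have c0 : Continuous (fun x : ℝ => F x) :=
    hcont.comp_continuous (by fun_prop) (by intro x; simp [hd.le])
  have c1 : Continuous (fun x : ℝ => F (x - d * Complex.I)) :=
    hcont.comp_continuous (by fun_prop) (by intro x; simp [hd.le])
  refine ⟨c1, ?_⟩
  have e0 := Complex.reCLM.intervalIntegral_comp_comm (c0.intervalIntegrable (μ := MeasureTheory.volume) (-π) π)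
  have e1 := Complex.reCLM.intervalIntegral_comp_comm (c1.intervalIntegrable (μ := MeasureTheory.volume) (-π) π)
  simp only [Complex.reCLM_apply] at e0 e1
  rw [e0, e1, strip_shift d hd F hcont hhol hper]

/-- if `B` is continuous and nowhere vanishing on the closed strip
`{−d ≤ Im z ≤ 0}`, holomorphic on the open strip, `2π`-periodic, real-valued on the line
`Im z = −d`, and the mean of `Re B` over a period on the real axis is `1`, then
`B(x − id) > 0` for all real `x`, and the mean of `Re(1/B)` over a period on the real
axis is positive. -/
theorem stmt6 (d : ℝ) (hd : 0 < d) (B : ℂ → ℂ)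
    (hcont : ContinuousOn B {z : ℂ | -d ≤ z.im ∧ z.im ≤ 0})
    (hne : ∀ z : ℂ, -d ≤ z.im → z.im ≤ 0 → B z ≠ 0)
    (hhol : DifferentiableOn ℂ B {z : ℂ | -d < z.im ∧ z.im < 0})
    (hper : ∀ z : ℂ, -d ≤ z.im → z.im ≤ 0 → B (z + (2 * π : ℝ)) = B z)
    (hreal : ∀ x : ℝ, (B (x - d * Complex.I)).im = 0)
    (hmean : (1 / (2 * π)) * ∫ x in (-π)..π, (B x).re = 1) :
    (∀ x : ℝ, 0 < (B (x - d * Complex.I)).re)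
    ∧ 0 < (1 / (2 * π)) * ∫ x in (-π)..π, ((B x)⁻¹).re := by
  have hpi := Real.pi_pos
  obtain ⟨c, e⟩ := strip_shift_re d hd B hcont hhol hper
  obtain ⟨c', e'⟩ := strip_shift_re d hd (fun z => (B z)⁻¹)
    (hcont.inv₀ fun z hz => hne z hz.1 hz.2)
    (hhol.inv fun z hz => hne z hz.1.le hz.2.le)
    (fun z h1 h2 => by simp only [hper z h1 h2])
  have cr : Continuous (fun x : ℝ => (B (x - d * Complex.I)).re) := Complex.continuous_re.comp c
  have hre : ∀ x : ℝ, (B (x - d * Complex.I)).re ≠ 0 := by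
    intro x h
    exact hne (x - d * Complex.I) (by simp) (by simp [hd.le]) (Complex.ext h (hreal x))
  have hpos : ∀ x : ℝ, 0 < (B (x - d * Complex.I)).re := by
    by_contra! hcon
    obtain ⟨x₀, hx₀⟩ := hcon
    have hneg : ∀ x : ℝ, (B (x - d * Complex.I)).re ≤ 0 := by
      intro x
      by_contra! hx
      obtain ⟨y, hy⟩ := mem_range_of_exists_le_of_exists_ge cr ⟨x₀, hx₀⟩ ⟨x, hx.le⟩
      exact hre y hy
    have hle : ∫ x in (-π)..π, (B ((x : ℝ) - d * Complex.I)).re ≤ 0 := by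
      rw [← neg_nonneg, ← intervalIntegral.integral_neg]
      exact intervalIntegral.integral_nonneg (by linarith) fun x _ => neg_nonneg.2 (hneg x)
    rw [e] at hmean
    have := mul_nonpos_of_nonneg_of_nonpos (by positivity : 0 ≤ 1 / (2 * π)) hle
    linarith
  refine ⟨hpos, mul_pos (by positivity) ?_⟩
  rw [e']
  apply intervalIntegral.intervalIntegral_pos_of_pos
  · exact (Complex.continuous_re.comp c').intervalIntegrable _ _
  · intro x
    rw [Complex.inv_re]
    refine div_pos (hpos x) (Complex.normSq_pos.2 fun h => hre x (by rw [h]; rfl))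
  · linarith
end

section
/- Let k, h > 0, α ∈ (0,1), and let w ∈ C^{2,α}_{2π,0} satisfy W_{kh}(w)(t) > 0 for all t ∈ ℝ. Assume that the holomorphic function B on the strip {z ∈ ℂ : −kh < Im z < 0}, continuous on the closed strip, 2π-periodic, real-valued on the line Im z = −kh, with boundary values B(x) = (1 + C_{kh}w'(x)) + i w'(x) on the real axis, is nowhere vanishing on the closed strip. Let w̃ ∈ C^{0,α}_{2π,0} satisfy, for all t ∈ ℝ, w''(t) = w'(t) · C_{kh}w̃(t) + (1 + C_{kh}w'(t)) · w̃(t). Then, for all t ∈ ℝ, w̃(t) = ((1 + C_{kh}w'(t)) w''(t) − w'(t) C_{kh}w''(t)) / W_{kh}(w)(t) and C_{kh}w̃(t) = (w'(t) w''(t) + (1 + C_{kh}w'(t)) C_{kh}w''(t)) / W_{kh}(w)(t). -/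
open Real MeasureTheory Filter

/-- hyperbolic cotangent -/
noncomputable def coth (x : ℝ) : ℝ := Real.cosh x / Real.sinh x

/-- `g` is the continuous (Hölder) representative of `C_d f`. -/
def IsConjFn (d : ℝ) (f g : ℝ → ℝ) : Prop :=
  Continuous g ∧ Function.Periodic g (2 * π) ∧ mean2 g = 0 ∧
    ∀ n : ℕ, 0 < n →
      fcos g n = - coth (n * d) * fsin f n ∧ fsin g n = coth (n * d) * fcos f n


/-- normalised complex Fourier coefficient of a function on `ℝ` -/
noncomputable def fc (f : ℝ → ℂ) (n : ℤ) : ℂ :=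
  (1 / (2 * π) : ℂ) * ∫ t in (-π)..π, Complex.exp (-(n * t * Complex.I)) * f t

instance fact2pi : Fact (0 < 2 * π) := ⟨by positivity⟩

noncomputable def lft (f : ℝ → ℂ) (hf : Continuous f) (hp : Function.Periodic f (2 * π)) :
    C(AddCircle (2 * π), ℂ) :=
  ⟨hp.lift, continuous_coinduced_dom.mpr hf⟩

theorem lft_coe (f : ℝ → ℂ) (hf : Continuous f) (hp : Function.Periodic f (2 * π)) (x : ℝ) :
    lft f hf hp (x : AddCircle (2 * π)) = f x := rfl

theorem fourier_two_pi (n : ℤ) (x : ℝ) :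
    fourier n (x : AddCircle (2 * π)) = Complex.exp (n * x * Complex.I) := by
  rw [fourier_coe_apply]
  congr 1
  have : (π : ℂ) ≠ 0 := by exact_mod_cast Real.pi_ne_zero
  push_cast
  field_simp

theorem fourierCoeff_eq_fc (g : AddCircle (2 * π) → ℂ) (n : ℤ) :
    fourierCoeff g n = fc (fun x : ℝ => g x) n := by
  rw [fourierCoeff_eq_intervalIntegral g n (-π), fc]
  rw [show -π + 2 * π = π by ring]
  simp_rw [fourier_two_pi]
  simp

theorem fc_eq_lft (f : ℝ → ℂ) (hf : Continuous f) (hp : Function.Periodic f (2 * π)) (n : ℤ) :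
    fc f n = fourierCoeff (lft f hf hp) n := by
  rw [fourierCoeff_eq_fc]; rfl

theorem fc_unique {f : ℝ → ℂ} (hf : Continuous f) (hp : Function.Periodic f (2 * π))
    (h : ∀ n, fc f n = 0) (t : ℝ) : f t = 0 := by
  have h0 : fourierCoeff (lft f hf hp) = fun _ => 0 := by
    funext n; rw [← fc_eq_lft, h]
  have := has_pointwise_sum_fourier_series_of_summable (f := lft f hf hp)
    (by rw [h0]; exact summable_zero) (t : AddCircle (2 * π))
  rw [h0] at this
  simp only [zero_smul] at this
  rw [lft_coe] at this
  exact this.unique hasSum_zero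

theorem fourierCoeff_inner (f : C(AddCircle (2 * π), ℂ)) (n : ℤ) :
    fourierCoeff f n = inner ℂ (fourierLp 2 n) (ContinuousMap.toLp 2 AddCircle.haarAddCircle ℂ f) := by
  rw [fourierLp, ContinuousMap.inner_toLp, fourierCoeff]
  simp only [fourier_neg, smul_eq_mul, mul_comm]

theorem fc_mul {f g : ℝ → ℂ} (hf : Continuous f) (hpf : Function.Periodic f (2 * π))
    (hg : Continuous g) (hpg : Function.Periodic g (2 * π)) (n : ℤ) :
    HasSum (fun i => fc g (n - i) * fc f i) (fc (fun t => g t * f t) n) := by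
  have hp : Function.Periodic (fun t => g t * f t) (2 * π) := fun t => by
    simp only [hpf t, hpg t]
  have H := (fourierBasis (T := 2 * π)).hasSum_inner_mul_inner
    (ContinuousMap.toLp 2 AddCircle.haarAddCircle ℂ (star (lft g hg hpg) * fourier n))
    (ContinuousMap.toLp 2 AddCircle.haarAddCircle ℂ (lft f hf hpf))
  have e1 : (fun i => fc g (n - i) * fc f i) = fun i =>
      inner ℂ (ContinuousMap.toLp 2 AddCircle.haarAddCircle ℂ (star (lft g hg hpg) * fourier n))
        (fourierBasis (T := 2 * π) i) *
      inner ℂ (fourierBasis (T := 2 * π) i)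
        (ContinuousMap.toLp 2 AddCircle.haarAddCircle ℂ (lft f hf hpf)) := by
    funext i
    rw [coe_fourierBasis, ← fourierCoeff_inner, fc_eq_lft f hf hpf, fourierLp,
      ContinuousMap.inner_toLp, fc_eq_lft g hg hpg, fourierCoeff]
    congr 1
    refine integral_congr_ae (ae_of_all _ fun x => ?_)
    simp only [ContinuousMap.mul_apply, ContinuousMap.star_apply, map_mul, smul_eq_mul,
      ← fourier_neg]
    rw [show -(n - i) = i + -n by ring, fourier_add]
    simp
    ring
  have e2 : fc (fun t => g t * f t) n =
      inner ℂ (ContinuousMap.toLp 2 AddCircle.haarAddCircle ℂ (star (lft g hg hpg) * fourier n))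
        (ContinuousMap.toLp 2 AddCircle.haarAddCircle ℂ (lft f hf hpf)) := by
    rw [ContinuousMap.inner_toLp, fc_eq_lft (fun t => g t * f t) (by fun_prop) hp, fourierCoeff]
    refine integral_congr_ae (ae_of_all _ fun x => ?_)
    have hm : lft (fun t => g t * f t) (by fun_prop) hp x = lft g hg hpg x * lft f hf hpf x := by
      induction x using QuotientAddGroup.induction_on with
      | H x => rfl
    simp only [ContinuousMap.mul_apply, ContinuousMap.star_apply, map_mul, smul_eq_mul,
      ← fourier_neg, hm]
    simp
    ring
  rw [e1, e2]
  exact H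

theorem fc_exists (β : ℤ → ℂ) (hβ : Summable fun n => ‖β n‖) :
    ∃ F : ℝ → ℂ, Continuous F ∧ Function.Periodic F (2 * π) ∧ ∀ n, fc F n = β n := by
  have hs : Summable (fun i : ℤ => β i • (fourier i : C(AddCircle (2 * π), ℂ))) := by
    apply Summable.of_norm
    simpa [norm_smul, fourier_norm] using hβ
  obtain ⟨G, hG⟩ := hs
  refine ⟨fun x => G (x : AddCircle (2 * π)), ?_, ?_, fun n => ?_⟩
  · exact G.continuous.comp (AddCircle.continuous_mk' _)
  · intro x
    simp
  · rw [← fourierCoeff_eq_fc, fourierCoeff_inner]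
    have h2 := (hG.mapL (ContinuousMap.toLp (E := ℂ) 2 AddCircle.haarAddCircle ℂ)).mapL
      (innerSL ℂ (fourierLp (T := 2 * π) 2 n))
    refine h2.unique ?_
    have : ∀ i : ℤ, (innerSL ℂ (fourierLp (T := 2 * π) 2 n))
        ((ContinuousMap.toLp (E := ℂ) 2 AddCircle.haarAddCircle ℂ)
          (β i • (fourier i : C(AddCircle (2 * π), ℂ)))) = if i = n then β n else 0 := by
      intro i
      rw [map_smul, map_smul, innerSL_apply_apply]
      have := orthonormal_iff_ite.mp (orthonormal_fourier (T := 2 * π)) n i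
      rw [fourierLp, fourierLp] at this
      rw [fourierLp, this]
      by_cases h : i = n
      · subst h; simp
      · simp [h, Ne.symm h]
    simp_rw [this]
    exact hasSum_ite_eq n (β n)

theorem fc_add {f g : ℝ → ℂ} (hf : Continuous f) (hg : Continuous g) (n : ℤ) :
    fc (fun t => f t + g t) n = fc f n + fc g n := by
  unfold fc
  rw [← mul_add, ← intervalIntegral.integral_add]
  · simp only [mul_add]
  · apply Continuous.intervalIntegrable; fun_prop
  · apply Continuous.intervalIntegrable; fun_prop

theorem fc_const_mul (c : ℂ) (f : ℝ → ℂ) (n : ℤ) :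
    fc (fun t => c * f t) n = c * fc f n := by
  unfold fc
  rw [mul_left_comm c, ← intervalIntegral.integral_const_mul c]
  congr 2
  funext t
  ring

theorem fc_sub {f g : ℝ → ℂ} (hf : Continuous f) (hg : Continuous g) (n : ℤ) :
    fc (fun t => f t - g t) n = fc f n - fc g n := by
  have := fc_add hf (g := fun t => (-1) * g t) (by fun_prop) n
  rw [fc_const_mul] at this
  simp only [neg_one_mul, ← sub_eq_add_neg] at this
  exact this

theorem fc_conj (f : ℝ → ℂ) (n : ℤ) :
    fc (fun t => (starRingEnd ℂ) (f t)) n = (starRingEnd ℂ) (fc f (-n)) := by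
  unfold fc
  rw [map_mul]
  congr 1
  · simp [Complex.conj_ofNat]
  · have := intervalIntegral.intervalIntegral_conj (a := -π) (b := π) (μ := volume)
      (f := fun t : ℝ => Complex.exp (-(((-n : ℤ) : ℂ) * t * Complex.I)) * f t)
    rw [← this]
    congr 1
    funext t
    rw [map_mul, ← Complex.exp_conj]
    simp

theorem fc_const (c : ℂ) (n : ℤ) : fc (fun _ => c) n = if n = 0 then c else 0 := by
  have h := fourierCoeff_inner (fourier 0) n
  have := orthonormal_iff_ite.mp (orthonormal_fourier (T := 2 * π)) n 0
  rw [fourierLp, fourierLp] at this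
  rw [fourierLp, this, fourierCoeff_eq_fc] at h
  simp only [fourier_zero] at h
  have h2 := fc_const_mul c (fun _ => 1) n
  rw [h] at h2
  simp at h2
  exact h2

theorem fc_norm_le {f : ℝ → ℂ} (hf : Continuous f) : ∃ C : ℝ, ∀ n, ‖fc f n‖ ≤ C := by
  obtain ⟨C, hC⟩ := isCompact_Icc.exists_bound_of_continuousOn (hf.continuousOn (s := Set.Icc (-π) π))
  refine ⟨‖(1 / (2 * π) : ℂ)‖ * (C * |π - -π|), fun n => ?_⟩
  unfold fc
  rw [norm_mul]
  gcongr
  apply intervalIntegral.norm_integral_le_of_norm_le_const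
  intro t ht
  rw [Set.uIoc_of_le (by linarith [Real.pi_pos])] at ht
  rw [norm_mul]
  have : ‖Complex.exp (-(n * t * Complex.I))‖ = 1 := by
    rw [show -((n : ℂ) * t * Complex.I) = ((-(n * t) : ℝ) : ℂ) * Complex.I by push_cast; ring]
    exact Complex.norm_exp_ofReal_mul_I _
  rw [this, one_mul]
  exact hC t ⟨ht.1.le, ht.2⟩

theorem exp_pi_int (n : ℤ) : Complex.exp (-(n * (π : ℝ) * Complex.I))
    = Complex.exp (-(n * (-π : ℝ) * Complex.I)) := by
  rw [Complex.exp_eq_exp_iff_exists_int]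
  exact ⟨-n, by push_cast; ring⟩

theorem fc_deriv {f D : ℝ → ℂ} (hp : Function.Periodic f (2 * π)) (hD : Continuous D)
    (h : ∀ t, HasDerivAt f (D t) t) (n : ℤ) : fc D n = Complex.I * n * fc f n := by
  unfold fc
  have hE : ∀ t : ℝ, HasDerivAt (fun t : ℝ => Complex.exp (-(n * t * Complex.I)))
      (-(n * Complex.I) * Complex.exp (-(n * t * Complex.I))) t := by
    intro t
    have h1 : HasDerivAt (fun t : ℝ => (-(n * t * Complex.I) : ℂ)) (-(n * Complex.I)) t := by
      have := (((hasDerivAt_id t).ofReal_comp).const_mul (n : ℂ)).mul_const Complex.I |>.neg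
      simpa [Function.comp_def] using! this
    have := h1.cexp
    rwa [mul_comm] at this
  have hf : Continuous f := continuous_iff_continuousAt.mpr fun t => (h t).continuousAt
  have ibp := intervalIntegral.integral_mul_deriv_eq_deriv_mul (a := -π) (b := π)
    (u := fun t : ℝ => Complex.exp (-(n * t * Complex.I))) (v := f)
    (u' := fun t => -(n * Complex.I) * Complex.exp (-(n * t * Complex.I))) (v' := D)
    (fun t _ => hE t) (fun t _ => h t)
    (by apply Continuous.intervalIntegrable; fun_prop)
    (by apply Continuous.intervalIntegrable; fun_prop)
  rw [ibp]
  have hpp : f π = f (-π) := by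
    have := hp (-π)
    rw [show -π + 2 * π = π by ring] at this
    exact this
  rw [exp_pi_int n, hpp, sub_self, zero_sub]
  simp only [mul_assoc]
  rw [intervalIntegral.integral_const_mul]
  simp only [neg_mul]
  rw [neg_neg]
  ring

theorem fc_zero (f : ℝ → ℂ) : fc f 0 = (1 / (2 * π) : ℂ) * ∫ t in (-π)..π, f t := by
  simp [fc]

theorem fc_antideriv {f D : ℝ → ℂ} (hf : Continuous f) (hp : Function.Periodic f (2 * π))
    (hD : Continuous D) (hpD : Function.Periodic D (2 * π))
    (h : ∀ n, fc D n = Complex.I * n * fc f n) (t : ℝ) : HasDerivAt f (D t) t := by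
  set H : ℝ → ℂ := fun t => ∫ s in (0 : ℝ)..t, D s with hH
  have hHd : ∀ t, HasDerivAt H (D t) t := fun t =>
    intervalIntegral.integral_hasDerivAt_right (hD.intervalIntegrable _ _)
      (hD.stronglyMeasurableAtFilter _ _) hD.continuousAt
  have hmean : ∫ t in (-π)..π, D t = 0 := by
    have := h 0
    rw [fc_zero] at this
    have hpi : (π : ℂ) ≠ 0 := by exact_mod_cast Real.pi_ne_zero
    simpa [hpi] using this
  have hHp : Function.Periodic H (2 * π) := by
    intro t
    have h1 : ∫ s in t..(t + 2 * π), D s = 0 := by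
      rw [hpD.intervalIntegral_add_eq t (-π), show -π + 2 * π = π by ring, hmean]
    have h2 := intervalIntegral.integral_add_adjacent_intervals (μ := volume)
      (hD.intervalIntegrable 0 t) (hD.intervalIntegrable t (t + 2 * π))
    simp only [hH]
    rw [← h2, h1, add_zero]
  have hHc : Continuous H := continuous_iff_continuousAt.mpr fun t => (hHd t).continuousAt
  have key : ∀ t, f t - H t - fc (fun t => f t - H t) 0 = 0 := by
    apply fc_unique
    · fun_prop
    · intro t; simp only [hp t, hHp t]
    · intro n
      rw [fc_sub (f := fun t => f t - H t) (by fun_prop) continuous_const, fc_const]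
      by_cases hn : n = 0
      · simp [hn]
      · rw [if_neg hn, sub_zero, fc_sub hf hHc]
        have h1 := h n
        rw [fc_deriv hHp hD hHd n] at h1
        have : Complex.I * n ≠ 0 := by simp [hn]
        rw [mul_left_cancel₀ this h1, sub_self]
  have : f = fun t => H t + fc (fun t => f t - H t) 0 := by
    funext t
    linear_combination key t
  rw [this]
  exact (hHd t).add_const _

theorem fc_ofReal_conj (φ : ℝ → ℝ) (n : ℤ) :
    (starRingEnd ℂ) (fc (fun t => (φ t : ℂ)) (-n)) = fc (fun t => (φ t : ℂ)) n := by
  rw [← fc_conj]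
  simp only [Complex.conj_ofReal]

theorem fc_ofReal_zero (φ : ℝ → ℝ) : fc (fun t => (φ t : ℂ)) 0 = (mean2 φ : ℂ) := by
  rw [fc_zero, mean2, intervalIntegral.integral_ofReal]
  push_cast
  ring

theorem fc_ofReal_nat {φ : ℝ → ℝ} (hφ : Continuous φ) (n : ℕ) :
    fc (fun t => (φ t : ℂ)) n = (1 / 2 : ℂ) * (fcos φ n - Complex.I * fsin φ n) := by
  unfold fc fcos fsin
  push_cast
  rw [← intervalIntegral.integral_ofReal, ← intervalIntegral.integral_ofReal]
  have : ∀ t : ℝ, Complex.exp (-((n : ℂ) * t * Complex.I)) * (φ t : ℂ)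
      = ((φ t * Real.cos (n * t) : ℝ) : ℂ) - Complex.I * ((φ t * Real.sin (n * t) : ℝ) : ℂ) := by
    intro t
    rw [show -((n : ℂ) * t * Complex.I) = ((-(n * t) : ℝ) : ℂ) * Complex.I by push_cast; ring,
      Complex.exp_mul_I, ← Complex.ofReal_cos, ← Complex.ofReal_sin, Real.cos_neg, Real.sin_neg]
    push_cast
    ring
  simp_rw [this]
  rw [intervalIntegral.integral_sub, intervalIntegral.integral_const_mul]
  · ring
  · apply Continuous.intervalIntegrable; fun_prop
  · apply Continuous.intervalIntegrable; fun_prop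

theorem fc_conjFn {d : ℝ} {φ g : ℝ → ℝ} (hφ : Continuous φ) (H : IsConjFn d φ g) (n : ℤ) :
    fc (fun t => (g t : ℂ)) n
      = -Complex.I * ((Real.cosh (n * d) / Real.sinh (n * d) : ℝ) : ℂ)
        * fc (fun t => (φ t : ℂ)) n := by
  obtain ⟨hg, hgp, hg0, hc⟩ := H
  have hpos : ∀ m : ℕ, 0 < m → fc (fun t => (g t : ℂ)) (m : ℤ)
      = -Complex.I * ((Real.cosh (m * d) / Real.sinh (m * d) : ℝ) : ℂ)
        * fc (fun t => (φ t : ℂ)) (m : ℤ) := by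
    intro m hm
    rw [fc_ofReal_nat hg, fc_ofReal_nat hφ, (hc m hm).1, (hc m hm).2, coth]
    push_cast
    linear_combination (-(1 / 2 : ℂ) * (Complex.cosh (m * d) / Complex.sinh (m * d)) * fsin φ m)
      * Complex.I_sq
  obtain ⟨m, rfl | rfl⟩ := n.eq_nat_or_neg
  · rcases Nat.eq_zero_or_pos m with rfl | hm
    · simp [fc_ofReal_zero, hg0]
    · exact_mod_cast hpos m hm
  · rcases Nat.eq_zero_or_pos m with rfl | hm
    · simp [fc_ofReal_zero, hg0]
    · rw [← fc_ofReal_conj g, ← fc_ofReal_conj φ, neg_neg, hpos m hm]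
      simp only [map_mul, map_neg, Complex.conj_I, Complex.conj_ofReal]
      push_cast
      rw [neg_mul (m : ℂ), Complex.cosh_neg, Complex.sinh_neg, div_neg]
      ring

/-- bottom coefficients -/
noncomputable def bet (d : ℝ) (φ : ℝ → ℝ) (n : ℤ) : ℂ :=
  -Complex.I * fc (fun t => (φ t : ℂ)) n / ((Real.sinh (n * d) : ℝ) : ℂ)

theorem bet_zero (d : ℝ) (φ : ℝ → ℝ) : bet d φ 0 = 0 := by simp [bet]

theorem bet_conj (d : ℝ) (φ : ℝ → ℝ) (n : ℤ) : (starRingEnd ℂ) (bet d φ (-n)) = bet d φ n := by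
  unfold bet
  rw [map_div₀, map_mul, fc_ofReal_conj, Complex.conj_ofReal]
  push_cast
  rw [neg_mul (n : ℂ), Complex.sinh_neg, div_neg]
  simp only [map_neg, Complex.conj_I]
  ring

theorem sinh_ne {d : ℝ} (hd : 0 < d) {n : ℤ} (hn : n ≠ 0) : Real.sinh (n * d) ≠ 0 := by
  rw [Ne, Real.sinh_eq_zero]
  simp [hn, hd.ne']

theorem sinh_ge {x : ℝ} (hx : 0 ≤ x) : x ^ 2 / 2 ≤ Real.sinh x := by
  have h1 : x / 2 ≤ Real.sinh (x / 2) := Real.self_le_sinh_iff.mpr (by linarith)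
  have h2 : Real.sinh (x / 2) < Real.cosh (x / 2) := Real.sinh_lt_cosh (x / 2)
  have h3 : Real.sinh x = 2 * Real.sinh (x / 2) * Real.cosh (x / 2) := by
    rw [← Real.sinh_two_mul]; congr 1; ring
  rw [h3]
  nlinarith

theorem abs_sinh_ge (x : ℝ) : x ^ 2 / 2 ≤ |Real.sinh x| := by
  rw [Real.abs_sinh, ← sq_abs]
  exact sinh_ge (abs_nonneg x)

theorem bet_summable {d : ℝ} (hd : 0 < d) {φ : ℝ → ℝ} (hφ : Continuous φ) :
    Summable fun n => ‖bet d φ n‖ := by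
  obtain ⟨C, hC⟩ := fc_norm_le (f := fun t => (φ t : ℂ)) (by fun_prop)
  have hs : Summable fun n : ℤ => (C * 2 / d ^ 2) * (1 / (n : ℝ) ^ 2) :=
    ((Real.summable_one_div_int_pow (p := 2)).mpr (by norm_num)).mul_left _
  refine Summable.of_nonneg_of_le (fun n => norm_nonneg _) (fun n => ?_) hs
  by_cases hn : n = 0
  · subst hn; simp [bet_zero]
  · have h1 := abs_sinh_ge (n * d)
    have hn' : (0 : ℝ) < (n : ℝ) ^ 2 := by positivity
    have hC0 : 0 ≤ C := (norm_nonneg _).trans (hC 0)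
    unfold bet
    rw [norm_div, norm_mul, norm_neg, Complex.norm_I, one_mul, Complex.norm_real, Real.norm_eq_abs]
    calc ‖fc (fun t => (φ t : ℂ)) n‖ / |Real.sinh (n * d)| ≤ C / ((n * d) ^ 2 / 2) := by
          gcongr
          exact hC n
      _ = _ := by field_simp

theorem fc_top {d : ℝ} (hd : 0 < d) {φ g : ℝ → ℝ} (hφ : Continuous φ) (hφ0 : mean2 φ = 0)
    (H : IsConjFn d φ g) (n : ℤ) :
    fc (fun t => (g t : ℂ) + Complex.I * φ t) n = ((Real.exp (-(n * d)) : ℝ) : ℂ) * bet d φ n := by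
  have hg : Continuous g := H.1
  rw [fc_add (f := fun t => (g t : ℂ)) (g := fun t => Complex.I * φ t) (by fun_prop) (by fun_prop),
    fc_const_mul, fc_conjFn hφ H]
  by_cases hn : n = 0
  · subst hn
    simp [bet_zero, fc_ofReal_zero, hφ0]
  · have hs : ((Real.sinh (n * d) : ℝ) : ℂ) ≠ 0 := by exact_mod_cast sinh_ne hd hn
    unfold bet
    rw [← Real.cosh_sub_sinh, Complex.ofReal_div, Complex.ofReal_sub]
    field_simp
    ring

theorem fc_bottom {d : ℝ} (hd : 0 < d) {B : ℂ → ℂ}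
    (hcont : ContinuousOn B {z : ℂ | -d ≤ z.im ∧ z.im ≤ 0})
    (hhol : DifferentiableOn ℂ B {z : ℂ | -d < z.im ∧ z.im < 0})
    (hper : ∀ z : ℂ, -d ≤ z.im → z.im ≤ 0 → B (z + (2 * π : ℝ)) = B z) (n : ℤ) :
    fc (fun x => B (x - d * Complex.I)) n
      = ((Real.exp (n * d) : ℝ) : ℂ) * fc (fun x => B x) n := by
  set f : ℂ → ℂ := fun z => Complex.exp (-(n * z * Complex.I)) * B z with hf
  have hpi := Real.pi_pos
  have hE : Differentiable ℂ fun z : ℂ => Complex.exp (-(n * z * Complex.I)) := by fun_prop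
  have key := Complex.integral_boundary_rect_eq_zero_of_continuousOn_of_differentiableOn f
    (⟨-π, -d⟩ : ℂ) (⟨π, 0⟩ : ℂ)
    (by
      refine ContinuousOn.mul hE.continuous.continuousOn (hcont.mono ?_)
      intro z hz
      have := hz.2
      simp only [Set.mem_preimage] at this
      rw [Set.uIcc_of_le (by linarith)] at this
      exact this)
    (by
      refine DifferentiableOn.mul hE.differentiableOn (hhol.mono ?_)
      intro z hz
      have := hz.2
      simp only [Set.mem_preimage] at this
      rw [min_eq_left (by linarith), max_eq_right (by linarith)] at this
      exact this)
  have hside : ∫ y : ℝ in (-d)..0, f ((π : ℝ) + y * Complex.I)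
      = ∫ y : ℝ in (-d)..0, f ((-π : ℝ) + y * Complex.I) := by
    apply intervalIntegral.integral_congr
    intro y hy
    rw [Set.uIcc_of_le (by linarith)] at hy
    have h1 := hper ((-π : ℝ) + y * Complex.I) (by simpa using hy.1) (by simpa using hy.2)
    have e : (((-π : ℝ) : ℂ) + y * Complex.I) + (2 * π : ℝ) = (π : ℝ) + y * Complex.I := by
      push_cast; ring
    rw [e] at h1
    simp only [hf]
    rw [h1]
    congr 1
    rw [Complex.exp_eq_exp_iff_exists_int]
    exact ⟨-n, by push_cast; ring⟩
  simp only at key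
  rw [hside, add_sub_cancel_right, sub_eq_zero] at key
  have hb : ∀ x : ℝ, f (x + ((-d : ℝ) : ℂ) * Complex.I) = ((Real.exp (-(n * d)) : ℝ) : ℂ) *
      (Complex.exp (-(n * x * Complex.I)) * B (x - d * Complex.I)) := by
    intro x
    simp only [hf]
    rw [show (x : ℂ) + ((-d : ℝ) : ℂ) * Complex.I = x - d * Complex.I by push_cast; ring,
      ← mul_assoc]
    congr 1
    rw [Complex.ofReal_exp, ← Complex.exp_add]
    congr 1
    push_cast
    linear_combination (n * d : ℂ) * Complex.I_sq
  simp_rw [hb] at key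
  rw [intervalIntegral.integral_const_mul] at key
  have ht : ∀ x : ℝ, f (x + ((0 : ℝ) : ℂ) * Complex.I)
      = Complex.exp (-(n * x * Complex.I)) * B x := by
    intro x; simp [hf]
  simp_rw [ht] at key
  unfold fc
  rw [← key]
  have : ((Real.exp (n * d) : ℝ) : ℂ) * ((Real.exp (-(n * d)) : ℝ) : ℂ) = 1 := by
    rw [← Complex.ofReal_mul, ← Real.exp_add]; simp
  linear_combination (-(1 / (2 * π) : ℂ) * ∫ x : ℝ in (-π)..π, Complex.exp (-(n * x * Complex.I)) * B (x - d * Complex.I)) * this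

theorem integral_inv_ne {b : ℝ → ℝ} (hb : Continuous b) (h0 : ∀ t, b t ≠ 0) :
    ∫ t in (-π)..π, (b t)⁻¹ ≠ 0 := by
  have hpi := Real.pi_pos
  have hpos : ∀ {b : ℝ → ℝ}, Continuous b → (∀ t, 0 < b t) → 0 < ∫ t in (-π)..π, (b t)⁻¹ := by
    intro b hb h
    apply intervalIntegral.intervalIntegral_pos_of_pos_on
    · exact (hb.inv₀ fun t => (h t).ne').intervalIntegrable _ _
    · intro t _
      exact inv_pos.mpr (h t)
    · linarith
  have hiv : ∀ s t, b s < 0 → ¬ 0 < b t := by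
    intro s t hs ht
    obtain ⟨x, hx⟩ := mem_range_of_exists_le_of_exists_ge hb ⟨s, hs.le⟩ ⟨t, ht.le⟩
    exact h0 x hx
  rcases lt_or_gt_of_ne (h0 0) with h | h
  · have hn : ∀ t, 0 < -b t := fun t => by
      have := hiv 0 t h
      have := h0 t
      rcases lt_or_gt_of_ne (h0 t) with h' | h' <;> [linarith; contradiction]
    have := hpos (b := fun t => -b t) hb.neg hn
    simp only [inv_neg, intervalIntegral.integral_neg] at this
    linarith
  · have hn : ∀ t, 0 < b t := fun t => by
      rcases lt_or_gt_of_ne (h0 t) with h' | h'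
      · exact absurd h (hiv t 0 h')
      · exact h'
    exact (hpos hb hn).ne'

theorem bet_fn {d : ℝ} (hd : 0 < d) {φ : ℝ → ℝ} (hφ : Continuous φ) :
    ∃ F : ℝ → ℝ, Continuous F ∧ Function.Periodic F (2 * π) ∧
      ∀ n, fc (fun t => (F t : ℂ)) n = bet d φ n := by
  obtain ⟨F, hF, hFp, hFc⟩ := fc_exists _ (bet_summable hd hφ)
  have hreal : ∀ t, (starRingEnd ℂ) (F t) - F t = 0 := by
    apply fc_unique
    · exact (Complex.continuous_conj.comp hF).sub hF
    · intro t; simp only [hFp t]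
    · intro n
      rw [fc_sub (f := fun t => (starRingEnd ℂ) (F t)) (Complex.continuous_conj.comp hF) hF,
        fc_conj, hFc, hFc, bet_conj, sub_self]
  have hre : ∀ t, ((F t).re : ℂ) = F t := fun t =>
    Complex.conj_eq_iff_re.mp (sub_eq_zero.mp (hreal t))
  refine ⟨fun t => (F t).re, Complex.continuous_re.comp hF, fun t => by simp only [hFp t], ?_⟩
  simp only [hre]
  exact hFc

theorem core {d : ℝ} (hd : 0 < d) {T : ℝ → ℂ} (hT : Continuous T)
    (hTp : Function.Periodic T (2 * π)) {b : ℝ → ℝ} (hb : Continuous b)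
    (hbp : Function.Periodic b (2 * π)) (hb0 : ∀ t, b t ≠ 0)
    (hbT : ∀ n : ℤ, fc (fun t => (b t : ℂ)) n = ((Real.exp (n * d) : ℝ) : ℂ) * fc T n)
    {φ g : ℝ → ℝ} (hφ : Continuous φ) (hφp : Function.Periodic φ (2 * π)) (hφ0 : mean2 φ = 0)
    (hg : IsConjFn d φ g)
    (hder : ∀ n : ℤ, fc (fun t => (g t : ℂ) + Complex.I * φ t) n = Complex.I * n * fc T n)
    {u v : ℝ → ℝ} (hu : Continuous u) (hup : Function.Periodic u (2 * π)) (hu0 : mean2 u = 0)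
    (hv : IsConjFn d u v)
    (him : ∀ t, (T t * ((v t : ℂ) + Complex.I * u t)).im = φ t) (t : ℝ) :
    T t * ((v t : ℂ) + Complex.I * u t) = (g t : ℂ) + Complex.I * φ t := by
  obtain ⟨F, hF, hFp, hFc⟩ := bet_fn hd hu
  obtain ⟨D, hD, hDp, hDc⟩ := bet_fn hd hφ
  have hvc := hv.1
  have hvp := hv.2.1
  have hgc := hg.1
  have hgp := hg.2.1
  have hexp : ∀ x : ℝ, ((Real.exp x : ℝ) : ℂ) * ((Real.exp (-x) : ℝ) : ℂ) = 1 := by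
    intro x
    rw [← Complex.ofReal_mul, ← Real.exp_add]; simp
  -- derivative at the bottom
  have hbD : ∀ t, HasDerivAt b (D t) t := by
    intro t
    have h1 : HasDerivAt (fun t => (b t : ℂ)) (D t : ℂ) t := by
      refine fc_antideriv (f := fun t => (b t : ℂ)) (D := fun t => (D t : ℂ)) (by fun_prop)
        (fun t => by simp only [hbp t]) (by fun_prop) (fun t => by simp only [hDp t]) (fun n => ?_) t
      have h2 := hder n
      rw [fc_top hd hφ hφ0 hg] at h2
      rw [hDc, hbT]
      linear_combination ((Real.exp (n * d) : ℝ) : ℂ) * h2 - bet d φ n * hexp (n * d)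
    have h3 := Complex.reCLM.hasFDerivAt.comp_hasDerivAt t h1
    simpa [Function.comp_def] using! h3
  -- the product
  set A : ℝ → ℂ := fun t => (v t : ℂ) + Complex.I * u t with hA
  have hAc : Continuous A := by fun_prop
  have hAp : Function.Periodic A (2 * π) := fun t => by simp only [hA, hup t, hvp t]
  have hprod : ∀ n : ℤ, fc (fun t => (b t : ℂ) * F t) n
      = ((Real.exp (n * d) : ℝ) : ℂ) * fc (fun t => T t * A t) n := by
    intro n
    have h1 := fc_mul hAc hAp hT hTp n
    have h2 := fc_mul (f := fun t => (F t : ℂ)) (g := fun t => (b t : ℂ)) (by fun_prop)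
      (fun t => by simp only [hFp t]) (by fun_prop) (fun t => by simp only [hbp t]) n
    refine h2.unique ?_
    have h3 := h1.mul_left ((Real.exp (n * d) : ℝ) : ℂ)
    refine h3.congr_fun ?_
    intro i
    rw [hbT, hFc, hA, fc_top hd hu hu0 hv]
    have e : ((Real.exp (n * d) : ℝ) : ℂ) = ((Real.exp ((n - i : ℤ) * d) : ℝ) : ℂ)
        * ((Real.exp (i * d) : ℝ) : ℂ) := by
      rw [← Complex.ofReal_mul, ← Real.exp_add]
      congr 2
      push_cast
      ring
    rw [e]
    linear_combination (-((Real.exp ((n - i : ℤ) * d) : ℝ) : ℂ) * fc T (n - i) * bet d u i)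
      * hexp (i * d)
  set p : ℤ → ℂ := fun n => fc (fun t => (b t : ℂ) * F t) n with hp
  have hpconj : ∀ n, (starRingEnd ℂ) (p (-n)) = p n := by
    intro n
    have := fc_ofReal_conj (fun t => b t * F t) n
    simp only [Complex.ofReal_mul] at this
    exact this
  have hP : ∀ n : ℤ, fc (fun t => T t * A t) n = ((Real.exp (-(n * d)) : ℝ) : ℂ) * p n := by
    intro n
    simp only [hp]
    rw [hprod]
    linear_combination (-fc (fun t => T t * A t) n) * hexp (n * d)
  have hpn : ∀ n : ℤ, n ≠ 0 → p n = bet d φ n := by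
    intro n hn
    have h1 : fc (fun t => T t * A t - (starRingEnd ℂ) (T t * A t)) n
        = 2 * Complex.I * fc (fun t => (φ t : ℂ)) n := by
      rw [← fc_const_mul]
      congr 1
      funext t
      rw [Complex.sub_conj, him t]
      push_cast
      ring
    have hTA : Continuous fun t => T t * A t := hT.mul hAc
    rw [fc_sub (g := fun t => (starRingEnd ℂ) (T t * A t)) hTA (Complex.continuous_conj.comp hTA), fc_conj, hP, hP, map_mul, hpconj,
      Complex.conj_ofReal] at h1
    have hs : ((Real.sinh (n * d) : ℝ) : ℂ) ≠ 0 := by exact_mod_cast sinh_ne hd hn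
    unfold bet
    rw [eq_div_iff hs, Real.sinh_eq]
    push_cast at h1 ⊢
    rw [neg_mul (n : ℂ), neg_neg] at h1
    linear_combination (-1 / 2 : ℂ) * h1
  have hbF : ∀ t, (b t : ℂ) * F t - D t - p 0 = 0 := by
    apply fc_unique
    · fun_prop
    · intro t; simp only [hbp t, hFp t, hDp t]
    · intro n
      rw [fc_sub (f := fun t => (b t : ℂ) * F t - D t) (by fun_prop) continuous_const,
        fc_sub (f := fun t => (b t : ℂ) * F t) (by fun_prop) (by fun_prop), fc_const, hDc]
      change p n - _ - _ = _
      by_cases hn : n = 0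
      · subst hn; simp [bet_zero]
      · simp [hn, hpn n hn]
  obtain ⟨c, hc⟩ : ∃ c : ℝ, (c : ℂ) = p 0 :=
    ⟨(p 0).re, Complex.conj_eq_iff_re.mp (by simpa using hpconj 0)⟩
  have hFeq : ∀ t, F t = D t / b t + c * (b t)⁻¹ := by
    intro t
    have h1 := hbF t
    rw [← hc] at h1
    have h2 : b t * F t - D t - c = 0 := by exact_mod_cast h1
    have := hb0 t
    field_simp
    linarith
  have hF0 : ∫ t in (-π)..π, F t = 0 := by
    have h1 := hFc 0
    rw [bet_zero, fc_ofReal_zero, mean2] at h1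
    have hpi := Real.pi_pos.ne'
    have h2 : (1 / (2 * π)) * ∫ t in (-π)..π, F t = 0 := by exact_mod_cast h1
    simpa [hpi] using h2
  have hlog : ∫ t in (-π)..π, D t / b t = 0 := by
    have := intervalIntegral.integral_eq_sub_of_hasDerivAt (a := -π) (b := π)
      (f := fun t => Real.log (b t)) (f' := fun t => D t / b t)
      (fun t _ => (hbD t).log (hb0 t))
      ((hD.div hb hb0).intervalIntegrable _ _)
    rw [this]
    have h2 := hbp (-π)
    rw [show -π + 2 * π = π by ring] at h2
    rw [h2, sub_self]
  have hc0 : c = 0 := by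
    have hinv := integral_inv_ne hb hb0
    simp_rw [hFeq] at hF0
    rw [intervalIntegral.integral_add (f := fun t => D t / b t) (g := fun t => c * (b t)⁻¹) ((hD.div hb hb0).intervalIntegrable _ _)
      ((continuous_const.mul (hb.inv₀ hb0)).intervalIntegrable _ _), hlog, zero_add,
      intervalIntegral.integral_const_mul] at hF0
    exact (mul_eq_zero.mp hF0).resolve_right hinv
  have hfin : ∀ t, T t * A t - ((g t : ℂ) + Complex.I * φ t) = 0 := by
    apply fc_unique
    · fun_prop
    · intro t; simp only [hTp t, hAp t, hgp t, hφp t]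
    · intro n
      rw [fc_sub (f := fun t => T t * A t) (by fun_prop) (by fun_prop), hP, fc_top hd hφ hφ0 hg]
      by_cases hn : n = 0
      · subst hn; rw [← hc, hc0, bet_zero]; simp
      · rw [hpn n hn, sub_self]
  exact sub_eq_zero.mp (hfin t)

/-- if `w ∈ C^{2,α}_{2π,0}` with `W_{kh}(w) > 0`, the holomorphic extension
`B` of `(1 + C_{kh}w') + i w'` is nowhere vanishing on the closed strip, and
`w̃ ∈ C^{0,α}_{2π,0}` satisfies `w'' = w' C_{kh}w̃ + (1 + C_{kh}w') w̃`, then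
`w̃ = ((1 + C_{kh}w')w'' − w' C_{kh}w'')/W_{kh}(w)` and
`C_{kh}w̃ = (w'w'' + (1 + C_{kh}w') C_{kh}w'')/W_{kh}(w)`. -/
theorem stmt10 (k h : ℝ) (hk : 0 < k) (hh : 0 < h)
    (α : NNReal) (hα0 : 0 < α) (hα1 : α < 1)
    (w Cw' Cw'' : ℝ → ℝ)
    (hw : ContDiff ℝ 2 w) (hwper : Function.Periodic w (2 * π)) (hwmean : mean2 w = 0)
    (hwHold : ∃ C : NNReal, HolderWith C α (deriv (deriv w)))
    (hCw' : IsConjFn (k * h) (deriv w) Cw')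
    (hCw'' : IsConjFn (k * h) (deriv (deriv w)) Cw'')
    (hWpos : ∀ t : ℝ, 0 < (deriv w t) ^ 2 + (1 + Cw' t) ^ 2)
    (B : ℂ → ℂ)
    (hcont : ContinuousOn B {z : ℂ | -(k * h) ≤ z.im ∧ z.im ≤ 0})
    (hhol : DifferentiableOn ℂ B {z : ℂ | -(k * h) < z.im ∧ z.im < 0})
    (hper : ∀ z : ℂ, -(k * h) ≤ z.im → z.im ≤ 0 → B (z + (2 * π : ℝ)) = B z)
    (hreal : ∀ x : ℝ, (B (x - (k * h) * Complex.I)).im = 0)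
    (hbnd : ∀ x : ℝ, B x = ((1 + Cw' x : ℝ) : ℂ) + (deriv w x : ℝ) * Complex.I)
    (hne : ∀ z : ℂ, -(k * h) ≤ z.im → z.im ≤ 0 → B z ≠ 0)
    (wt Cwt : ℝ → ℝ)
    -- `w̃ ∈ C^{0,α}_{2π,0}`
    (hwt : ∃ C : NNReal, HolderWith C α wt)
    (hwtper : Function.Periodic wt (2 * π)) (hwtmean : mean2 wt = 0)
    (hCwt : IsConjFn (k * h) wt Cwt)
    (heq : ∀ t : ℝ, deriv (deriv w) t = deriv w t * Cwt t + (1 + Cw' t) * wt t) :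
    (∀ t : ℝ, wt t = ((1 + Cw' t) * deriv (deriv w) t - deriv w t * Cw'' t)
        / ((deriv w t) ^ 2 + (1 + Cw' t) ^ 2))
    ∧ ∀ t : ℝ, Cwt t = (deriv w t * deriv (deriv w) t + (1 + Cw' t) * Cw'' t)
        / ((deriv w t) ^ 2 + (1 + Cw' t) ^ 2) := by
  have hd : 0 < k * h := mul_pos hk hh
  set d := k * h with hdd
  have hw1 : ContDiff ℝ 1 (deriv w) := by
    have : ContDiff ℝ (1 + 1) w := by simpa [one_add_one_eq_two] using hw
    exact (contDiff_succ_iff_deriv.mp this).2.2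
  have hw'c : Continuous (deriv w) := hw1.continuous
  have hw''c : Continuous (deriv (deriv w)) := hw1.continuous_deriv le_rfl
  have hper_deriv : ∀ f : ℝ → ℝ, Function.Periodic f (2 * π) →
      Function.Periodic (deriv f) (2 * π) := by
    intro f hf t
    rw [← deriv_comp_add_const]
    congr 1
    funext x
    exact hf x
  have hw'p := hper_deriv w hwper
  have hw''p := hper_deriv _ hw'p
  have hcoef : ∀ f : ℝ → ℝ, Differentiable ℝ f → Function.Periodic f (2 * π) →
      Continuous (deriv f) → ∀ n : ℤ, fc (fun t => ((deriv f t : ℝ) : ℂ)) n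
        = Complex.I * n * fc (fun t => (f t : ℂ)) n := by
    intro f hf hp hc n
    exact fc_deriv (f := fun t => (f t : ℂ)) (fun t => by simp only [hp t]) (by fun_prop)
      (fun t => (hf t).hasDerivAt.ofReal_comp) n
  have hc1 := hcoef w (hw.differentiable (by norm_num)) hwper hw'c
  have hc2 := hcoef _ (hw1.differentiable (by norm_num)) hw'p hw''c
  have hm1 : mean2 (deriv w) = 0 := by
    have := hc1 0
    rw [fc_ofReal_zero] at this
    simpa using this
  have hm2 : mean2 (deriv (deriv w)) = 0 := by
    have := hc2 0
    rw [fc_ofReal_zero] at this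
    simpa using this
  have hwtc : Continuous wt := by
    obtain ⟨C, hC⟩ := hwt
    exact hC.continuous hα0
  have hCc := hCw'.1
  have hCp := hCw'.2.1
  -- top and bottom boundary values
  have hT : ∀ n : ℤ, fc (fun x : ℝ => B x) n
      = (if n = 0 then 1 else 0) + fc (fun t => (Cw' t : ℂ) + Complex.I * (deriv w t : ℝ)) n := by
    intro n
    rw [← fc_const, ← fc_add continuous_const (by fun_prop)]
    congr 1
    funext t
    rw [hbnd]
    push_cast
    ring
  have hTc : Continuous fun x : ℝ => B x := by
    have : (fun x : ℝ => B x) = fun x : ℝ => ((1 + Cw' x : ℝ) : ℂ) + (deriv w x : ℝ) * Complex.I :=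
      funext hbnd
    rw [this]
    fun_prop
  have hTp : Function.Periodic (fun x : ℝ => B x) (2 * π) := by
    intro x
    simp only [hbnd, hCp x, hw'p x]
  have hbre : ∀ x : ℝ, (((B (x - d * Complex.I)).re : ℝ) : ℂ) = B (x - d * Complex.I) := by
    intro x
    apply Complex.ext
    · simp
    · have := hreal x
      simp only [Complex.ofReal_im]
      rw [← this]
      simp [hdd]
  have him' : ∀ x : ℝ, ((x : ℂ) - d * Complex.I).im = -d := by intro x; simp
  have hbc : Continuous fun x : ℝ => B (x - d * Complex.I) := by
    refine hcont.comp_continuous (by fun_prop) (fun x => ?_)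
    rw [Set.mem_setOf_eq, him']
    constructor <;> linarith
  have key := core hd (T := fun x : ℝ => B x) hTc hTp
    (b := fun x => (B (x - d * Complex.I)).re) (Complex.continuous_re.comp hbc)
    (by
      intro x
      have := hper (x - d * Complex.I) (by rw [him']) (by rw [him']; linarith)
      simp only
      rw [← this]
      congr 2
      push_cast
      ring)
    (by
      intro x h0
      have h1 := hbre x
      rw [h0] at h1
      exact hne (x - d * Complex.I) (by rw [him']) (by rw [him']; linarith) (by rw [← h1]; simp))
    (by
      intro n
      simp only [hbre]
      exact fc_bottom hd hcont hhol hper n)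
    hw''c hw''p hm2 hCw''
    (by
      intro n
      rw [hT, fc_top hd hw''c hm2 hCw'', fc_top hd hw'c hm1 hCw']
      by_cases hn : n = 0
      · subst hn; simp [bet_zero]
      · rw [if_neg hn, zero_add]
        unfold bet
        rw [hc2]
        ring)
    hwtc hwtper hwtmean hCwt
    (by
      intro t
      simp only [hbnd]
      rw [heq t]
      simp
      ring)
  have hre : ∀ t, (1 + Cw' t) * Cwt t - deriv w t * wt t = Cw'' t := by
    intro t
    have := congrArg Complex.re (key t)
    simp only [hbnd] at this
    simpa using this
  constructor
  · intro t
    rw [eq_div_iff (hWpos t).ne', ← hre t, heq t]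
    ring
  · intro t
    rw [eq_div_iff (hWpos t).ne', ← hre t, heq t]
    ring
end
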